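/- Let k be an infinite field and let d ≥ 5. For general forms f₁, f₂, f₃ of degree d in R = k[x,y], setting I = (f₁, f₂, f₃) with J ⊆ I a minimal reduction generated by two general k-linear combinations of f₁, f₂, f₃, the length of I/J is λ(I/J) = d²/4 if d is even and λ(I/J) = (d²−1)/4 if d is odd (i.e., λ(I/J) = ⌊d²/4⌋). -/

import Mathlib

open MvPolynomial

noncomputable section

/-- The binary form of degree `d` in `k[x,y]` with coefficient vector `c`
(`x := X 0`, `y := X 1`). -/
def formOf {k : Type*} [Field k] (d : ℕ) (c : Fin (d + 1) → k) :
    MvPolynomial (Fin 2) k :=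
  ∑ l : Fin (d + 1), C (c l) * X 0 ^ (l : ℕ) * X 1 ^ (d - (l : ℕ))

/-- `J` is a reduction of `I` : `J ⊆ I` and `I^{n+1} = J·I^n` for some `n`. -/
def IsReduction {A : Type*} [CommRing A] (I J : Ideal A) : Prop :=
  J ≤ I ∧ ∃ n : ℕ, I ^ (n + 1) = J * I ^ n

/-- `J` is a minimal reduction of `I` : a reduction minimal w.r.t. inclusion. -/
def IsMinimalReduction {A : Type*} [CommRing A] (I J : Ideal A) : Prop :=
  IsReduction I J ∧ ∀ J' : Ideal A, IsReduction I J' → J' ≤ J → J' = J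

/-- The length `λ(M)` of a module: the supremum of the lengths of strictly
increasing chains of submodules (the height of `⊤` in the submodule lattice). -/
def moduleLength (A M : Type*) [CommRing A] [AddCommGroup M] [Module A M] : ℕ∞ :=
  Order.height (⊤ : Submodule A M)

/-- Polynomials all of whose monomials have degree less than `n`. -/
abbrev degreeLTSubmodule (k : Type*) [Field k] (n : ℕ) : Submodule k (MvPolynomial (Fin 2) k) :=
  restrictSupport k {e | e.degree < n}

lemma mem_degreeLTSubmodule_iff {k : Type*} [Field k] {n : ℕ} {p : MvPolynomial (Fin 2) k} :
    p ∈ degreeLTSubmodule k n ↔ ∀ e, n ≤ e.degree → coeff e p = 0 := by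
  rw [mem_restrictSupport_iff]
  constructor
  · intro h e he
    by_contra hc
    have : e.degree < n := h (mem_support_iff.2 hc)
    omega
  · intro h e he
    by_contra hc
    exact mem_support_iff.1 he (h e (not_lt.1 hc))

lemma exists_degreeLT_sub_mem_pow {k : Type*} [Field k] (n : ℕ) (p : MvPolynomial (Fin 2) k) :
    ∃ a ∈ degreeLTSubmodule k n, p - a ∈ idealOfVars (Fin 2) k ^ n := by
  classical
  have hc : ∀ e, coeff e (∑ t ∈ Finset.range n, homogeneousComponent t p) =
      if e.degree < n then coeff e p else 0 := by
    intro e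
    simp [coeff_sum, coeff_homogeneousComponent]
  refine ⟨∑ t ∈ Finset.range n, homogeneousComponent t p, ?_, ?_⟩
  · rw [mem_degreeLTSubmodule_iff]
    intro e he
    rw [hc, if_neg (not_lt.2 he)]
  · rw [mem_pow_idealOfVars_iff']
    intro e he
    rw [coeff_sub, hc, if_pos he, sub_self]

lemma eq_zero_of_mem_degreeLT_of_mem_pow {k : Type*} [Field k] {n : ℕ}
    {p : MvPolynomial (Fin 2) k} (h : p ∈ degreeLTSubmodule k n)
    (h' : p ∈ idealOfVars (Fin 2) k ^ n) : p = 0 := by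
  ext e
  rw [mem_degreeLTSubmodule_iff] at h
  rw [mem_pow_idealOfVars_iff'] at h'
  rcases lt_or_ge e.degree n with he | he
  · simpa using h' e he
  · simpa using h e he

lemma card_exponents_degree_lt (n : ℕ) :
    Nat.card {e : Fin 2 →₀ ℕ // e.degree < n} = n * (n + 1) / 2 := by
  have e1 : {e : Fin 2 →₀ ℕ // e.degree < n} ≃
      (Finset.range n).sigma (fun t => Finset.HasAntidiagonal.antidiagonal t) :=
    { toFun := fun e => ⟨⟨e.1 0 + e.1 1, (e.1 0, e.1 1)⟩, by
        have := e.2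
        rw [Finsupp.degree_eq_sum, Fin.sum_univ_two] at this
        simp [this]⟩
      invFun := fun q => ⟨Finsupp.equivFunOnFinite.symm ![q.1.2.1, q.1.2.2], by
        have := q.2
        simp only [Finset.mem_sigma, Finset.mem_range, Finset.HasAntidiagonal.mem_antidiagonal] at this
        rw [Finsupp.degree_eq_sum, Fin.sum_univ_two]
        simp
        omega⟩
      left_inv := by
        rintro ⟨e, he⟩
        ext i
        fin_cases i <;> simp
      right_inv := by
        rintro ⟨⟨t, a, b⟩, hq⟩
        simp only [Finset.mem_sigma, Finset.mem_range, Finset.HasAntidiagonal.mem_antidiagonal] at hq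
        obtain ⟨-, rfl⟩ := hq
        simp }
  rw [Nat.card_congr e1, Nat.card_eq_fintype_card, Fintype.card_coe, Finset.card_sigma]
  simp only [Finset.Nat.card_antidiagonal]
  have := Finset.sum_range_id_mul_two (n + 1)
  rw [Finset.sum_range_succ'] at this
  simp only [add_zero, Nat.add_sub_cancel] at this
  rw [mul_comm (n + 1)] at this
  omega

lemma finite_exponents_degree_lt (n : ℕ) : Finite {e : Fin 2 →₀ ℕ // e.degree < n} := by
  rcases Nat.eq_zero_or_pos n with rfl | hn
  · have : IsEmpty {e : Fin 2 →₀ ℕ // e.degree < 0} := ⟨fun e => by simpa using e.2⟩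
    infer_instance
  · apply Nat.finite_of_card_ne_zero
    rw [card_exponents_degree_lt]
    have : 1 * 2 ≤ n * (n + 1) := Nat.mul_le_mul hn (by omega)
    omega

instance {k : Type*} [Field k] (n : ℕ) : FiniteDimensional k (degreeLTSubmodule k n) :=
  have : Finite ↑{e : Fin 2 →₀ ℕ | e.degree < n} := finite_exponents_degree_lt n
  Module.Finite.of_basis (basisRestrictSupport k {e : Fin 2 →₀ ℕ | e.degree < n})

lemma finrank_degreeLTSubmodule (k : Type*) [Field k] (n : ℕ) :
    Module.finrank k (degreeLTSubmodule k n) = n * (n + 1) / 2 := by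
  rw [Module.finrank_eq_nat_card_basis
    (basisRestrictSupport k {e : Fin 2 →₀ ℕ | e.degree < n})]
  exact card_exponents_degree_lt n

/-- Multiplication `(a_i) ↦ ∑ a_i g_i` is injective on tuples of forms of degree `s`. -/
def FormsInjective {k : Type*} [Field k] {r : ℕ} (g : Fin r → MvPolynomial (Fin 2) k)
    (s : ℕ) : Prop :=
  ∀ a : Fin r → MvPolynomial (Fin 2) k, (∀ i, (a i).IsHomogeneous s) →
    ∑ i, a i * g i = 0 → a = 0

/-- Every form of degree `d + s` is a combination `∑ a_i g_i` with forms `a_i` of degree `s`. -/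
def FormsSurjective {k : Type*} [Field k] {r : ℕ} (g : Fin r → MvPolynomial (Fin 2) k)
    (d s : ℕ) : Prop :=
  ∀ p : MvPolynomial (Fin 2) k, p.IsHomogeneous (d + s) →
    ∃ a : Fin r → MvPolynomial (Fin 2) k, (∀ i, (a i).IsHomogeneous s) ∧ ∑ i, a i * g i = p

lemma MvPolynomial.IsHomogeneous.mem_pow_idealOfVars {k : Type*} [Field k] {n : ℕ}
    {p : MvPolynomial (Fin 2) k} (hp : p.IsHomogeneous n) : p ∈ idealOfVars (Fin 2) k ^ n := by
  rw [mem_pow_idealOfVars_iff']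
  intro e he
  exact hp.coeff_eq_zero he.ne

lemma homogeneousComponent_mul_of_isHomogeneous {k : Type*} [Field k] {d s : ℕ}
    {g : MvPolynomial (Fin 2) k} (hg : g.IsHomogeneous d) (a : MvPolynomial (Fin 2) k) :
    homogeneousComponent (d + s) (a * g) = homogeneousComponent s a * g := by
  classical
  conv_lhs => rw [← sum_homogeneousComponent a, Finset.sum_mul, map_sum]
  have h : ∀ i, homogeneousComponent (d + s) (homogeneousComponent i a * g) =
      if i = s then homogeneousComponent s a * g else 0 := by
    intro i
    have hm : homogeneousComponent i a * g ∈ homogeneousSubmodule (Fin 2) k (i + d) :=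
      (homogeneousComponent_isHomogeneous i a).mul hg
    rw [homogeneousComponent_of_mem hm]
    by_cases h : i = s
    · subst h
      rw [if_pos (by omega), if_pos rfl]
    · rw [if_neg (by omega), if_neg h]
  simp_rw [h]
  rw [Finset.sum_ite_eq']
  split_ifs with hs
  · rfl
  · rw [homogeneousComponent_eq_zero, zero_mul]
    simpa using hs

lemma FormsSurjective.pow_le {k : Type*} [Field k] {r : ℕ} {g : Fin r → MvPolynomial (Fin 2) k}
    {d s : ℕ} (h : FormsSurjective g d s) :
    idealOfVars (Fin 2) k ^ (d + s) ≤
      Ideal.span (Set.range g) * idealOfVars (Fin 2) k ^ s := by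
  rw [pow_idealOfVars_eq_span, Ideal.span_le]
  rintro _ ⟨e, he, rfl⟩
  obtain ⟨a, ha, hs⟩ := h (monomial e 1) (isHomogeneous_monomial _ he)
  simp only [SetLike.mem_coe]
  rw [← hs]
  refine Ideal.sum_mem _ fun i _ => ?_
  rw [mul_comm (a i)]
  exact Ideal.mul_mem_mul (Ideal.subset_span (Set.mem_range_self i)) ((ha i).mem_pow_idealOfVars)

/-- Injectivity on forms of degree `s` implies injectivity on polynomials of degree at most `s`. -/
lemma FormsInjective.eq_zero {k : Type*} [Field k] {r : ℕ}
    {g : Fin r → MvPolynomial (Fin 2) k} {d s : ℕ} (hg : ∀ i, (g i).IsHomogeneous d)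
    (h : FormsInjective g s) (a : Fin r → MvPolynomial (Fin 2) k)
    (ha : ∀ i, a i ∈ degreeLTSubmodule k (s + 1)) (h0 : ∑ i, a i * g i = 0) : a = 0 := by
  have key : ∀ t, t ≤ s → ∀ i, homogeneousComponent t (a i) = 0 := by
    intro t ht i
    have h1 := congrArg (homogeneousComponent (d + t)) h0
    rw [map_sum, map_zero] at h1
    simp_rw [fun i => homogeneousComponent_mul_of_isHomogeneous (s := t) (hg i) (a i)] at h1
    have h2 := h (fun i => X 0 ^ (s - t) * homogeneousComponent t (a i)) (fun i => by
      have := ((isHomogeneous_X_pow (R := k) (0 : Fin 2) (s - t)).mul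
        (homogeneousComponent_isHomogeneous t (a i)))
      rwa [Nat.sub_add_cancel ht] at this) (by
      simp_rw [mul_assoc]
      rw [← Finset.mul_sum, h1, mul_zero])
    have h3 := congrFun h2 i
    simp only [Pi.zero_apply, mul_eq_zero] at h3
    exact h3.resolve_left (pow_ne_zero _ (X_ne_zero _))
  funext i
  ext e
  rcases lt_or_ge s e.degree with he | he
  · simpa using mem_degreeLTSubmodule_iff.1 (ha i) e he
  · have := congrArg (coeff e) (key _ he i)
    simpa [coeff_homogeneousComponent] using this

/-- If the multiplication map is injective in degree `s` and surjective in degree `s + 1`, this is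
the dimension of the quotient by the ideal of `r` forms of degree `d`. -/
lemma finrank_quotient_span_forms {k : Type*} [Field k] {r : ℕ}
    {g : Fin r → MvPolynomial (Fin 2) k} {d s : ℕ} (hg : ∀ i, (g i).IsHomogeneous d)
    (hi : FormsInjective g s) (hs : FormsSurjective g d (s + 1)) :
    Module.Finite k (MvPolynomial (Fin 2) k ⧸ Ideal.span (Set.range g)) ∧
    Module.finrank k (MvPolynomial (Fin 2) k ⧸ Ideal.span (Set.range g)) +
      r * ((s + 1) * (s + 2) / 2) = (d + s + 1) * (d + s + 2) / 2 := by
  set I := Ideal.span (Set.range g) with hI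
  have hpow : idealOfVars (Fin 2) k ^ (d + (s + 1)) ≤ I := hs.pow_le.trans Ideal.mul_le_left
  let φ : degreeLTSubmodule k (d + (s + 1)) →ₗ[k] (MvPolynomial (Fin 2) k ⧸ I) :=
    (Ideal.Quotient.mkₐ k I).toLinearMap ∘ₗ (degreeLTSubmodule k (d + (s + 1))).subtype
  have hφ : ∀ p, φ p = Ideal.Quotient.mk I p.1 := fun p => rfl
  have hφs : Function.Surjective φ := by
    intro q
    obtain ⟨p, rfl⟩ := Ideal.Quotient.mk_surjective q
    obtain ⟨a, ha, hpa⟩ := exists_degreeLT_sub_mem_pow (d + (s + 1)) p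
    refine ⟨⟨a, ha⟩, ?_⟩
    rw [hφ]
    exact (Ideal.Quotient.eq.2 (hpow hpa)).symm
  have hmul : ∀ (a : MvPolynomial (Fin 2) k) (i : Fin r), a ∈ degreeLTSubmodule k (s + 1) →
      a * g i ∈ degreeLTSubmodule k (d + (s + 1)) := by
    intro a i ha
    rw [mem_degreeLTSubmodule_iff] at ha ⊢
    intro e he
    obtain ⟨t, ht⟩ := Nat.exists_eq_add_of_le he
    have h1 := congrArg (coeff e)
      (homogeneousComponent_mul_of_isHomogeneous (s := s + 1 + t) (hg i) a)
    rw [coeff_homogeneousComponent, if_pos (by omega)] at h1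
    rw [h1]
    have : homogeneousComponent (s + 1 + t) a = 0 := by
      ext e'
      rw [coeff_homogeneousComponent]
      split_ifs with h
      · simpa using ha e' (by omega)
      · simp
    rw [this, zero_mul, coeff_zero]
  let ψ : (Fin r → degreeLTSubmodule k (s + 1)) →ₗ[k] degreeLTSubmodule k (d + (s + 1)) :=
    { toFun := fun a => ⟨∑ i, (a i).1 * g i, Submodule.sum_mem _ fun i _ => hmul _ _ (a i).2⟩
      map_add' := fun a b => by
        ext1
        simp [add_mul, Finset.sum_add_distrib]
      map_smul' := fun c a => by
        ext1
        simp [Finset.smul_sum] }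
  have hψ : ∀ a, (ψ a).1 = ∑ i, (a i).1 * g i := fun a => rfl
  have hψi : Function.Injective ψ := by
    rw [← LinearMap.ker_eq_bot, LinearMap.ker_eq_bot']
    intro a ha
    have := hi.eq_zero hg (fun i => (a i).1) (fun i => (a i).2) (by
      rw [← hψ, ha]; rfl)
    funext i
    ext1
    exact congrFun this i
  have hker : LinearMap.ker φ = LinearMap.range ψ := by
    apply le_antisymm
    · rintro ⟨p, hp⟩ hpk
      rw [LinearMap.mem_ker, hφ, Ideal.Quotient.eq_zero_iff_mem] at hpk
      obtain ⟨b, hb⟩ := (Ideal.mem_span_range_iff_exists_fun).1 hpk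
      choose a ha hba using fun i => exists_degreeLT_sub_mem_pow (s + 1) (b i)
      refine ⟨fun i => ⟨a i, ha i⟩, ?_⟩
      ext1
      rw [hψ]
      symm
      rw [← sub_eq_zero]
      apply eq_zero_of_mem_degreeLT_of_mem_pow (n := d + (s + 1))
      · exact Submodule.sub_mem _ hp (Submodule.sum_mem _ fun i _ => hmul _ _ (ha i))
      · change p - _ ∈ _
        rw [show p = _ from hb.symm, ← Finset.sum_sub_distrib]
        refine Ideal.sum_mem _ fun i _ => ?_
        rw [← sub_mul, mul_comm, pow_add]
        exact Ideal.mul_mem_mul ((hg i).mem_pow_idealOfVars) (hba i)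
    · rintro _ ⟨a, rfl⟩
      rw [LinearMap.mem_ker, hφ, Ideal.Quotient.eq_zero_iff_mem, hψ]
      exact Ideal.sum_mem _ fun i _ => Ideal.mul_mem_left _ _ (Ideal.subset_span ⟨i, rfl⟩)
  have hfin : Module.Finite k (MvPolynomial (Fin 2) k ⧸ I) := Module.Finite.of_surjective φ hφs
  refine ⟨hfin, ?_⟩
  have h1 := LinearMap.finrank_range_add_finrank_ker φ
  rw [LinearMap.range_eq_top.2 hφs, finrank_top, hker, LinearMap.finrank_range_of_inj hψi,
    Module.finrank_pi_fintype] at h1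
  simp only [finrank_degreeLTSubmodule, Finset.sum_const, Finset.card_univ, Fintype.card_fin,
    smul_eq_mul] at h1
  exact h1

lemma MvPolynomial.sub_C_constantCoeff_mem_idealOfVars {k : Type*} [Field k]
    (p : MvPolynomial (Fin 2) k) : p - C (constantCoeff p) ∈ idealOfVars (Fin 2) k := by
  rw [← pow_one (idealOfVars (Fin 2) k), mem_pow_idealOfVars_iff']
  intro e he
  have : e = 0 := by
    rw [← Finsupp.degree_eq_zero_iff]
    omega
  subst this
  simp [constantCoeff_eq]

lemma finrank_eq_one_of_isSimpleModule {k Q : Type*} [Field k] [AddCommGroup Q]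
    [Module (MvPolynomial (Fin 2) k) Q] [Module k Q] [IsScalarTower k (MvPolynomial (Fin 2) k) Q]
    [IsSimpleModule (MvPolynomial (Fin 2) k) Q] {n : ℕ}
    (h : ∀ p ∈ idealOfVars (Fin 2) k ^ n, ∀ x : Q, p • x = 0) : Module.finrank k Q = 1 := by
  have := IsSimpleModule.nontrivial (MvPolynomial (Fin 2) k) Q
  have hbot : idealOfVars (Fin 2) k • (⊤ : Submodule (MvPolynomial (Fin 2) k) Q) = ⊥ := by
    refine (eq_bot_or_eq_top _).resolve_right fun htop => ?_
    have hpow : ∀ m, idealOfVars (Fin 2) k ^ m •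
        (⊤ : Submodule (MvPolynomial (Fin 2) k) Q) = ⊤ := by
      intro m
      induction m with
      | zero => simp
      | succ m ih => rw [pow_succ, Submodule.mul_smul, htop, ih]
    have hle : idealOfVars (Fin 2) k ^ n • (⊤ : Submodule (MvPolynomial (Fin 2) k) Q) ≤ ⊥ :=
      Submodule.smul_le.2 fun p hp x _ => by simpa using h p hp x
    rw [hpow n, top_le_iff] at hle
    exact bot_ne_top hle
  obtain ⟨v, hv⟩ := exists_ne (0 : Q)
  refine finrank_eq_one v hv fun w => ?_
  obtain ⟨p, rfl⟩ := IsSimpleModule.toSpanSingleton_surjective (MvPolynomial (Fin 2) k) hv w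
  refine ⟨constantCoeff p, ?_⟩
  have h0 : (p - C (constantCoeff p)) • v = 0 := by
    have := Submodule.smul_mem_smul (sub_C_constantCoeff_mem_idealOfVars p)
      (Submodule.mem_top (x := v) (R := MvPolynomial (Fin 2) k))
    rwa [hbot, Submodule.mem_bot] at this
  rw [sub_smul, sub_eq_zero] at h0
  rw [LinearMap.toSpanSingleton_apply, h0, ← algebraMap_eq, algebraMap_smul]

/-- The length over `k[x,y]` of a module killed by a power of `(x,y)` is its length over `k`. -/
lemma length_eq_length_of_pow_smul_eq_zero {k : Type*} [Field k] {n : ℕ} {M : Type*}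
    [AddCommGroup M] [Module (MvPolynomial (Fin 2) k) M]
    (hM : IsFiniteLength (MvPolynomial (Fin 2) k) M) :
    ∀ [Module k M] [IsScalarTower k (MvPolynomial (Fin 2) k) M],
      (∀ p ∈ idealOfVars (Fin 2) k ^ n, ∀ x : M, p • x = 0) →
        Module.length (MvPolynomial (Fin 2) k) M = Module.length k M := by
  induction hM with
  | of_subsingleton =>
    intro _ _ _
    rw [Module.length_eq_zero, Module.length_eq_zero]
  | @of_simple_quotient M _ _ N _ _ ih =>
    intro _ _ h
    rw [Module.length_eq_add_of_exact N.subtype N.mkQ N.injective_subtype N.mkQ_surjective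
        (LinearMap.exact_subtype_mkQ N),
      Module.length_eq_add_of_exact (R := k) (N.subtype.restrictScalars k)
        (N.mkQ.restrictScalars k) N.injective_subtype N.mkQ_surjective
        (LinearMap.exact_subtype_mkQ N), ih,
      Module.length_eq_one (MvPolynomial (Fin 2) k) (M ⧸ N),
      (Module.length_eq_one_iff (R := k) (M := M ⧸ N)).2]
    · rw [isSimpleModule_iff_finrank_eq_one]
      refine finrank_eq_one_of_isSimpleModule (n := n) fun p hp x => ?_
      obtain ⟨x, rfl⟩ := N.mkQ_surjective x
      rw [← map_smul, h p hp, map_zero]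
    · intro p hp x
      ext1
      exact h p hp x

lemma length_quotient_eq_finrank {k : Type*} [Field k] {n : ℕ}
    {I : Ideal (MvPolynomial (Fin 2) k)} (hI : idealOfVars (Fin 2) k ^ n ≤ I)
    [Module.Finite k (MvPolynomial (Fin 2) k ⧸ I)] :
    Module.length (MvPolynomial (Fin 2) k) (MvPolynomial (Fin 2) k ⧸ I) =
      Module.finrank k (MvPolynomial (Fin 2) k ⧸ I) := by
  rw [← Module.length_eq_finrank]
  refine length_eq_length_of_pow_smul_eq_zero (n := n) ?_ ?_
  · rw [isFiniteLength_iff_isNoetherian_isArtinian]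
    exact ⟨isNoetherian_of_tower k inferInstance, isArtinian_of_tower k inferInstance⟩
  · intro p hp x
    obtain ⟨x, rfl⟩ := Ideal.Quotient.mk_surjective x
    rw [← Ideal.Quotient.mk_eq_mk, ← Submodule.Quotient.mk_smul, Submodule.Quotient.mk_eq_zero]
    exact I.mul_mem_right _ (hI hp)

/-- Additivity of length for `J ⊆ I ⊆ A`. -/
lemma length_quotient_eq_add {A : Type*} [CommRing A] {I J : Ideal A} (h : J ≤ I) :
    Module.length A (A ⧸ J) =
      Module.length A (↥I ⧸ Submodule.comap I.subtype J) + Module.length A (A ⧸ I) := by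
  refine Module.length_eq_add_of_exact
    (Submodule.mapQ (Submodule.comap I.subtype J) J I.subtype le_rfl)
    (Submodule.mapQ J I LinearMap.id h) ?_ ?_ ?_
  · rw [← LinearMap.ker_eq_bot, Submodule.ker_mapQ]
    exact Submodule.mkQ_map_self _
  · exact Submodule.factor_surjective h
  · rw [LinearMap.exact_iff, Submodule.ker_mapQ, Submodule.range_mapQ, Submodule.range_subtype,
      Submodule.comap_id]

lemma sup_pow_succ_le {A : Type*} [CommRing A] (J H : Ideal A) (n : ℕ) :
    (J ⊔ H) ^ (n + 1) ≤ J * (J ⊔ H) ^ n ⊔ H ^ (n + 1) := by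
  induction n with
  | zero => simp
  | succ n ih =>
    calc (J ⊔ H) ^ (n + 1 + 1) = J * (J ⊔ H) ^ (n + 1) ⊔ H * (J ⊔ H) ^ (n + 1) := by
          rw [pow_succ' _ (n + 1), Ideal.sup_mul]
      _ ≤ J * (J ⊔ H) ^ (n + 1) ⊔ H * (J * (J ⊔ H) ^ n ⊔ H ^ (n + 1)) :=
          sup_le_sup_left (Ideal.mul_mono_right ih) _
      _ ≤ _ := by
          rw [Ideal.mul_sup, ← pow_succ']
          refine sup_le le_sup_left (sup_le (le_sup_of_le_left ?_) le_sup_right)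
          rw [mul_left_comm, pow_succ']
          exact Ideal.mul_mono_right (Ideal.mul_mono_left le_sup_right)

/-- The determinant trick: if `h K ⊆ J K` for a nonzero finitely generated ideal `K` of a domain,
then `J` is a reduction of `J + (h)`. -/
lemma isReduction_sup_span_singleton {A : Type*} [CommRing A] [IsDomain A] {J K : Ideal A} {h : A}
    (hK : K.FG) (hK0 : K ≠ ⊥) (hm : ∀ a ∈ K, h * a ∈ J * K) :
    IsReduction (J ⊔ Ideal.span {h}) J := by
  have : Module.Finite A K := Module.Finite.iff_fg.2 hK
  obtain ⟨p, hp, -, hc, h0⟩ :=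
    LinearMap.exists_monic_and_natDegree_eq_and_coeff_mem_pow_and_aeval_eq_zero A
      (algebraMap A (Module.End A K) h) J (by
        rintro _ ⟨x, rfl⟩
        rw [Submodule.mem_smul_top_iff]
        exact hm x.1 x.2)
  have h1 : Polynomial.eval h p = 0 := by
    rw [Polynomial.aeval_algebraMap_apply] at h0
    obtain ⟨a, ha, ha0⟩ := Submodule.exists_mem_ne_zero_of_ne_bot hK0
    have := congrArg (fun f : Module.End A K => (f ⟨a, ha⟩ : A)) h0
    simpa [ha0] using this
  refine ⟨le_sup_left, p.natDegree, le_antisymm ?_ ?_⟩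
  · refine (sup_pow_succ_le _ _ _).trans (sup_le le_rfl ?_)
    rw [Ideal.span_singleton_pow, Ideal.span_le, Set.singleton_subset_iff, SetLike.mem_coe]
    rw [Polynomial.eval_eq_sum_range, Finset.sum_range_succ, hp.coeff_natDegree, one_mul] at h1
    rw [pow_succ, eq_neg_of_add_eq_zero_right h1, neg_mul, neg_mem_iff, Finset.sum_mul]
    refine Ideal.sum_mem _ fun i hi => ?_
    rw [Finset.mem_range] at hi
    rw [mul_assoc, ← pow_succ]
    have hI : h ∈ J ⊔ Ideal.span {h} := Ideal.mem_sup_right (Ideal.mem_span_singleton_self h)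
    have h2 := Ideal.mul_mem_mul (hc i) (Ideal.pow_mem_pow hI (i + 1))
    obtain ⟨t, ht⟩ := Nat.exists_eq_add_of_lt hi
    rw [show p.natDegree - i = t + 1 by omega, pow_succ', mul_assoc] at h2
    refine Ideal.mul_mono_right ?_ h2
    calc J ^ t * (J ⊔ Ideal.span {h}) ^ (i + 1)
        ≤ (J ⊔ Ideal.span {h}) ^ t * (J ⊔ Ideal.span {h}) ^ (i + 1) :=
          Ideal.mul_mono_left (Ideal.pow_right_mono le_sup_left t)
      _ = (J ⊔ Ideal.span {h}) ^ p.natDegree := by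
          rw [← pow_add, ht]
          congr 1
          omega
  · rw [pow_succ']
    exact Ideal.mul_mono_left le_sup_left

lemma not_dvd_of_pow_le_span_pair {k : Type*} [Field k] {g₀ g₁ π : MvPolynomial (Fin 2) k} {N : ℕ}
    (hN : idealOfVars (Fin 2) k ^ N ≤ Ideal.span {g₀, g₁}) (hπ : Irreducible π)
    (h₀ : π ∣ g₀) (h₁ : π ∣ g₁) : False := by
  have hle : Ideal.span {g₀, g₁} ≤ Ideal.span {π} := by
    rw [Ideal.span_le]
    rintro _ (rfl | rfl)
    · exact Ideal.mem_span_singleton.2 h₀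
    · exact Ideal.mem_span_singleton.2 h₁
  have hX : ∀ i : Fin 2, π ∣ X i := fun i =>
    hπ.prime.dvd_of_dvd_pow (Ideal.mem_span_singleton.1 (hle (hN
      (Ideal.pow_mem_pow (Ideal.subset_span (Set.mem_range_self i)) N))))
  have h := (hπ.associated_of_dvd (X_prime (R := k) (i := (0 : Fin 2))).irreducible (hX 0)).symm.dvd
  have := (X_dvd_X (R := k)).1 (h.trans (hX 1))
  exact absurd this (by decide)

/-- Two forms generating a primary ideal do not have powers divisible by a common form of
positive degree. -/
lemma not_dvd_pow_of_pow_le_span_pair {k : Type*} [Field k] {g₀ g₁ l : MvPolynomial (Fin 2) k}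
    {N d n : ℕ} (hN : idealOfVars (Fin 2) k ^ N ≤ Ideal.span {g₀, g₁}) (hd : 0 < d)
    (hl : l.IsHomogeneous d) (h₀ : l ∣ g₀ ^ n) (h₁ : l ∣ g₁ ^ n) : False := by
  by_cases hl0 : l = 0
  · subst hl0
    have e₀ := eq_zero_of_pow_eq_zero (zero_dvd_iff.1 h₀)
    have e₁ := eq_zero_of_pow_eq_zero (zero_dvd_iff.1 h₁)
    have hX := X_prime (R := k) (i := (0 : Fin 2))
    exact not_dvd_of_pow_le_span_pair hN hX.irreducible (by simp [e₀]) (by simp [e₁])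
  · have hu : ¬ IsUnit l := by
      intro hu
      have h1 := hu.map (constantCoeff (R := k) (σ := Fin 2))
      rw [constantCoeff_eq, hl.coeff_eq_zero (by simpa using hd.ne)] at h1
      exact not_isUnit_zero h1
    obtain ⟨π, hπ, hπl⟩ := WfDvdMonoid.exists_irreducible_factor hu hl0
    exact not_dvd_of_pow_le_span_pair hN hπ (hπ.prime.dvd_of_dvd_pow (hπl.trans h₀))
      (hπ.prime.dvd_of_dvd_pow (hπl.trans h₁))

lemma exists_combination_of_not_le {k : Type*} [Field k] {g₀ g₁ : MvPolynomial (Fin 2) k}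
    {J' : Ideal (MvPolynomial (Fin 2) k)} (hJ' : J' ≤ Ideal.span {g₀, g₁})
    (h : ¬ Ideal.span {g₀, g₁} ≤ J' ⊔ idealOfVars (Fin 2) k * Ideal.span {g₀, g₁}) :
    ∃ α β : k, J' ≤ Ideal.span {C β * g₀ - C α * g₁} ⊔
      idealOfVars (Fin 2) k * Ideal.span {g₀, g₁} := by
  set J := Ideal.span {g₀, g₁} with hJ
  have hg₀ : g₀ ∈ J := Ideal.subset_span (by simp)
  have hg₁ : g₁ ∈ J := Ideal.subset_span (by simp)
  let V : Submodule k (k × k) :=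
    { carrier := {v | C v.1 * g₀ + C v.2 * g₁ ∈ J' ⊔ idealOfVars (Fin 2) k * J}
      zero_mem' := by simp
      add_mem' := by
        intro v w hv hw
        have := Ideal.add_mem (J' ⊔ idealOfVars (Fin 2) k * J) hv hw
        simp only [Set.mem_ofPred_eq, Prod.fst_add, Prod.snd_add, C_add] at this ⊢
        convert this using 1
        ring
      smul_mem' := by
        intro c v hv
        have := Ideal.mul_mem_left (J' ⊔ idealOfVars (Fin 2) k * J) (C c) hv
        simp only [Set.mem_ofPred_eq, Prod.smul_fst, Prod.smul_snd, smul_eq_mul, C_mul] at this ⊢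
        convert this using 1
        ring }
  have hV : ∀ v, v ∈ V ↔ C v.1 * g₀ + C v.2 * g₁ ∈ J' ⊔ idealOfVars (Fin 2) k * J :=
    fun v => Iff.rfl
  have hVtop : V < ⊤ := by
    rw [lt_top_iff_ne_top]
    intro htop
    refine h ?_
    rw [hJ, Ideal.span_le, ← hJ]
    rintro _ (rfl | rfl)
    · have : ((1, 0) : k × k) ∈ V := htop ▸ Submodule.mem_top
      simpa [hV] using this
    · have : ((0, 1) : k × k) ∈ V := htop ▸ Submodule.mem_top
      simpa [hV] using this
  obtain ⟨f, hf0, hf⟩ := Submodule.exists_le_ker_of_lt_top V hVtop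
  have hfe : ∀ a b : k, f (a, b) = a * f (1, 0) + b * f (0, 1) := by
    intro a b
    have : ((a, b) : k × k) = a • (1, 0) + b • (0, 1) := by simp
    rw [this, map_add, map_smul, map_smul, smul_eq_mul, smul_eq_mul]
  have hab : f (1, 0) ≠ 0 ∨ f (0, 1) ≠ 0 := by
    by_contra! hc
    apply hf0
    ext
    · simpa using hc.1
    · simpa using hc.2
  refine ⟨f (1, 0), f (0, 1), fun j hj => ?_⟩
  obtain ⟨p, q, rfl⟩ := Ideal.mem_span_pair.1 (hJ' hj)
  have hm : (p - C (constantCoeff p)) * g₀ + (q - C (constantCoeff q)) * g₁ ∈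
      idealOfVars (Fin 2) k * J :=
    Ideal.add_mem _ (Ideal.mul_mem_mul (sub_C_constantCoeff_mem_idealOfVars p) hg₀)
      (Ideal.mul_mem_mul (sub_C_constantCoeff_mem_idealOfVars q) hg₁)
  have hv : (constantCoeff p, constantCoeff q) ∈ V := by
    rw [hV]
    have := Ideal.sub_mem _ (Ideal.mem_sup_left (T := idealOfVars (Fin 2) k * J) hj)
      (Ideal.mem_sup_right (S := J') hm)
    convert this using 1
    ring
  have h0 := hf hv
  rw [LinearMap.mem_ker, hfe] at h0
  have hl : C (constantCoeff p) * g₀ + C (constantCoeff q) * g₁ ∈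
      Ideal.span {C (f (0, 1)) * g₀ - C (f (1, 0)) * g₁} := by
    rw [Ideal.mem_span_singleton]
    rcases hab with ha | hb
    · refine ⟨C (-(constantCoeff q / f (1, 0))), ?_⟩
      have e1 : constantCoeff p = -(constantCoeff q / f (1, 0)) * f (0, 1) := by
        field_simp
        linear_combination h0
      have e2 : constantCoeff q = (constantCoeff q / f (1, 0)) * f (1, 0) := by
        field_simp
      rw [e1]
      nth_rw 2 [e2]
      simp only [C_mul, C_neg]
      ring
    · refine ⟨C (constantCoeff p / f (0, 1)), ?_⟩
      have e1 : constantCoeff q = -(constantCoeff p / f (0, 1)) * f (1, 0) := by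
        field_simp
        linear_combination h0
      have e2 : constantCoeff p = (constantCoeff p / f (0, 1)) * f (0, 1) := by
        field_simp
      rw [e1]
      nth_rw 1 [e2]
      simp only [C_mul, C_neg]
      ring
  have := Ideal.add_mem _ (Ideal.mem_sup_left (T := idealOfVars (Fin 2) k * J) hl)
    (Ideal.mem_sup_right (S := Ideal.span {C (f (0, 1)) * g₀ - C (f (1, 0)) * g₁}) hm)
  convert this using 1
  ring

lemma dvd_of_mem_span_sup_pow {k : Type*} [Field k] {l p : MvPolynomial (Fin 2) k} {d s : ℕ}
    (hl : l.IsHomogeneous d) (hp : p.IsHomogeneous (d + s))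
    (h : p ∈ Ideal.span {l} ⊔ idealOfVars (Fin 2) k ^ (d + s + 1)) : l ∣ p := by
  obtain ⟨a, ha, b, hb, rfl⟩ := Submodule.mem_sup.1 h
  obtain ⟨c, rfl⟩ := Ideal.mem_span_singleton'.1 ha
  rw [← homogeneousComponent_eq_self hp, map_add, homogeneousComponent_mul_of_isHomogeneous hl]
  have : homogeneousComponent (d + s) b = 0 := by
    ext e
    rw [coeff_homogeneousComponent]
    split_ifs with he
    · exact (mem_pow_idealOfVars_iff' _ _).1 hb e (by omega)
    · simp
  rw [this, add_zero]
  exact dvd_mul_left _ _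

/-- Reductions contained in an ideal `(g₀, g₁)` primary to `(x, y)`, where `g₀, g₁` are forms of
the initial degree of the ideal being reduced, coincide with `(g₀, g₁)`. -/
lemma eq_span_pair_of_isReduction {k : Type*} [Field k] {g₀ g₁ : MvPolynomial (Fin 2) k}
    {I J' : Ideal (MvPolynomial (Fin 2) k)} {d N : ℕ} (hd : 0 < d) (h₀ : g₀.IsHomogeneous d)
    (h₁ : g₁.IsHomogeneous d) (hJI : Ideal.span {g₀, g₁} ≤ I)
    (hI : I ≤ idealOfVars (Fin 2) k ^ d) (hN : idealOfVars (Fin 2) k ^ N ≤ Ideal.span {g₀, g₁})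
    (hr : IsReduction I J') (hJ' : J' ≤ Ideal.span {g₀, g₁}) : J' = Ideal.span {g₀, g₁} := by
  obtain ⟨-, n, hn⟩ := hr
  refine le_antisymm hJ' ?_
  have key : Ideal.span {g₀, g₁} ≤ J' ⊔ idealOfVars (Fin 2) k * Ideal.span {g₀, g₁} := by
    by_contra hc
    obtain ⟨α, β, hαβ⟩ := exists_combination_of_not_le hJ' hc
    set l := C β * g₀ - C α * g₁ with hl
    have hlh : l.IsHomogeneous d := (h₀.C_mul β).sub (h₁.C_mul α)
    have hle : I ^ (n + 1) ≤ Ideal.span {l} ⊔ idealOfVars (Fin 2) k ^ (d + d * n + 1) := by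
      rw [hn]
      refine (Ideal.mul_mono_left hαβ).trans ?_
      rw [Ideal.sup_mul]
      refine sup_le_sup Ideal.mul_le_left ?_
      calc idealOfVars (Fin 2) k * Ideal.span {g₀, g₁} * I ^ n
          ≤ idealOfVars (Fin 2) k * idealOfVars (Fin 2) k ^ d * (idealOfVars (Fin 2) k ^ d) ^ n :=
            Ideal.mul_mono (Ideal.mul_mono_right (hJI.trans hI)) (Ideal.pow_right_mono hI n)
        _ = idealOfVars (Fin 2) k ^ (d + d * n + 1) := by ring
    have hdvd : ∀ g ∈ ({g₀, g₁} : Set (MvPolynomial (Fin 2) k)), g.IsHomogeneous d →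
        l ∣ g ^ (n + 1) := by
      intro g hg hgh
      refine dvd_of_mem_span_sup_pow hlh ?_
        (hle (Ideal.pow_mem_pow (hJI (Ideal.subset_span hg)) (n + 1)))
      have := hgh.pow (n + 1)
      rwa [mul_add, mul_one, add_comm (d * n)] at this
    exact not_dvd_pow_of_pow_le_span_pair hN hd hlh (hdvd g₀ (by simp) h₀) (hdvd g₁ (by simp) h₁)
  have hiter : ∀ m, Ideal.span {g₀, g₁} ≤
      J' ⊔ idealOfVars (Fin 2) k ^ m * Ideal.span {g₀, g₁} := by
    intro m
    induction m with
    | zero => simp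
    | succ m ih =>
      refine ih.trans (sup_le le_sup_left ?_)
      refine (Ideal.mul_mono_right key).trans ?_
      rw [Ideal.mul_sup, ← mul_assoc, ← pow_succ]
      exact sup_le_sup_right Ideal.mul_le_right _
  refine (hiter (N * (n + 1))).trans (sup_le le_rfl (Ideal.mul_le_left.trans ?_))
  calc idealOfVars (Fin 2) k ^ (N * (n + 1)) = (idealOfVars (Fin 2) k ^ N) ^ (n + 1) :=
        pow_mul _ _ _
    _ ≤ I ^ (n + 1) := Ideal.pow_right_mono (hN.trans hJI) _
    _ ≤ J' := hn ▸ Ideal.mul_le_left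

instance (s : ℕ) : Finite {e : Fin 2 →₀ ℕ // e.degree = s} :=
  have := finite_exponents_degree_lt (s + 1)
  Finite.of_injective
    (fun e => (⟨e.1, by omega⟩ : {e : Fin 2 →₀ ℕ // e.degree < s + 1}))
    fun e e' h => Subtype.ext (Subtype.mk.inj h)

instance (s : ℕ) : Fintype {e : Fin 2 →₀ ℕ // e.degree = s} := Fintype.ofFinite _

/-- The form of degree `s` with the given coefficients. -/
def formOfCoeffs {A : Type*} [CommRing A] {s : ℕ}
    (v : {e : Fin 2 →₀ ℕ // e.degree = s} → A) : MvPolynomial (Fin 2) A :=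
  ∑ e, monomial e.1 (v e)

lemma isHomogeneous_formOfCoeffs {A : Type*} [CommRing A] {s : ℕ}
    (v : {e : Fin 2 →₀ ℕ // e.degree = s} → A) : (formOfCoeffs v).IsHomogeneous s :=
  IsHomogeneous.sum _ _ _ fun e _ => isHomogeneous_monomial _ e.2

lemma coeff_formOfCoeffs {A : Type*} [CommRing A] {s : ℕ}
    (v : {e : Fin 2 →₀ ℕ // e.degree = s} → A) (e : {e : Fin 2 →₀ ℕ // e.degree = s}) :
    coeff e.1 (formOfCoeffs v) = v e := by
  classical
  simp only [formOfCoeffs, coeff_sum, coeff_monomial]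
  rw [Finset.sum_eq_single e (fun b _ hb => if_neg fun h => hb (Subtype.ext h)) (by simp),
    if_pos rfl]

lemma MvPolynomial.IsHomogeneous.ext_coeff {A : Type*} [CommRing A] {s : ℕ}
    {p q : MvPolynomial (Fin 2) A} (hp : p.IsHomogeneous s) (hq : q.IsHomogeneous s)
    (h : ∀ e : {e : Fin 2 →₀ ℕ // e.degree = s}, coeff e.1 p = coeff e.1 q) : p = q := by
  ext e
  by_cases he : e.degree = s
  · exact h ⟨e, he⟩
  · rw [hp.coeff_eq_zero he, hq.coeff_eq_zero he]

lemma formOfCoeffs_coeff {A : Type*} [CommRing A] {s : ℕ} {p : MvPolynomial (Fin 2) A}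
    (hp : p.IsHomogeneous s) :
    formOfCoeffs (fun e : {e : Fin 2 →₀ ℕ // e.degree = s} => coeff e.1 p) = p :=
  (isHomogeneous_formOfCoeffs _).ext_coeff hp (coeff_formOfCoeffs _)

/-- The matrix of `(a_i) ↦ ∑ a_i G_i` from tuples of forms of degree `s` to forms of degree
`d + s`, with respect to the monomials. -/
def mulMatrix {A : Type*} [CommRing A] {r : ℕ} (G : Fin r → MvPolynomial (Fin 2) A) (d s : ℕ) :
    Matrix {e : Fin 2 →₀ ℕ // e.degree = d + s} (Fin r × {e : Fin 2 →₀ ℕ // e.degree = s}) A :=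
  Matrix.of fun t q => coeff t.1 (monomial q.2.1 1 * G q.1)

lemma mulMatrix_map {A B : Type*} [CommRing A] [CommRing B] (φ : A →+* B) {r : ℕ}
    (G : Fin r → MvPolynomial (Fin 2) A) (d s : ℕ) :
    (mulMatrix G d s).map φ = mulMatrix (fun i => map φ (G i)) d s := by
  ext t q
  simp only [mulMatrix, Matrix.map_apply, Matrix.of_apply]
  rw [← coeff_map, map_mul, map_monomial, map_one]

lemma mulMatrix_mulVec {A : Type*} [CommRing A] {r : ℕ} (G : Fin r → MvPolynomial (Fin 2) A)
    (d s : ℕ) (v : Fin r × {e : Fin 2 →₀ ℕ // e.degree = s} → A)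
    (t : {e : Fin 2 →₀ ℕ // e.degree = d + s}) :
    (mulMatrix G d s).mulVec v t =
      coeff t.1 (∑ i, formOfCoeffs (fun e => v (i, e)) * G i) := by
  simp only [Matrix.mulVec, dotProduct, mulMatrix, Matrix.of_apply, Fintype.sum_prod_type,
    coeff_sum, formOfCoeffs, Finset.sum_mul]
  refine Finset.sum_congr rfl fun i _ => Finset.sum_congr rfl fun e _ => ?_
  rw [mul_comm, ← coeff_C_mul, ← mul_assoc, C_mul_monomial, mul_one]

lemma isHomogeneous_sum_mul {A : Type*} [CommRing A] {r d s : ℕ}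
    {g a : Fin r → MvPolynomial (Fin 2) A} (hg : ∀ i, (g i).IsHomogeneous d)
    (ha : ∀ i, (a i).IsHomogeneous s) : (∑ i, a i * g i).IsHomogeneous (d + s) :=
  IsHomogeneous.sum _ _ _ fun i _ => add_comm s d ▸ (ha i).mul (hg i)

lemma formsInjective_iff {k : Type*} [Field k] {r d s : ℕ} {g : Fin r → MvPolynomial (Fin 2) k}
    (hg : ∀ i, (g i).IsHomogeneous d) :
    FormsInjective g s ↔ ∀ v, (mulMatrix g d s).mulVec v = 0 → v = 0 := by
  constructor
  · intro h v hv
    have h1 := h (fun i => formOfCoeffs fun e => v (i, e))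
      (fun i => isHomogeneous_formOfCoeffs _)
      ((isHomogeneous_sum_mul hg fun i => isHomogeneous_formOfCoeffs _).ext_coeff
        (isHomogeneous_zero _ _ _) fun e => by
          rw [← mulMatrix_mulVec, hv, coeff_zero, Pi.zero_apply])
    funext ⟨i, e⟩
    have := congrArg (coeff e.1) (congrFun h1 i)
    rw [coeff_formOfCoeffs] at this
    simpa using this
  · intro h a ha h0
    have h1 := h (fun q => coeff q.2.1 (a q.1)) (by
      funext t
      rw [mulMatrix_mulVec]
      simp_rw [fun i => formOfCoeffs_coeff (ha i)]
      rw [h0, coeff_zero, Pi.zero_apply])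
    funext i
    exact (ha i).ext_coeff (isHomogeneous_zero _ _ _) fun e => by
      simpa using congrFun h1 (i, e)

lemma formsSurjective_iff {k : Type*} [Field k] {r d s : ℕ} {g : Fin r → MvPolynomial (Fin 2) k}
    (hg : ∀ i, (g i).IsHomogeneous d) :
    FormsSurjective g d s ↔ Function.Surjective (mulMatrix g d s).mulVec := by
  constructor
  · intro h v
    obtain ⟨a, ha, hav⟩ := h (formOfCoeffs v) (isHomogeneous_formOfCoeffs v)
    refine ⟨fun q => coeff q.2.1 (a q.1), ?_⟩
    funext t
    rw [mulMatrix_mulVec]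
    simp_rw [fun i => formOfCoeffs_coeff (ha i)]
    rw [hav, coeff_formOfCoeffs]
  · intro h p hp
    obtain ⟨v, hv⟩ := h fun e => coeff e.1 p
    refine ⟨fun i => formOfCoeffs fun e => v (i, e), fun i => isHomogeneous_formOfCoeffs _, ?_⟩
    refine (isHomogeneous_sum_mul hg fun i => isHomogeneous_formOfCoeffs _).ext_coeff hp fun e => ?_
    rw [← mulMatrix_mulVec, hv]

/-- Injectivity of a polynomially parametrized matrix is an open condition. -/
lemma exists_eval_ne_zero_of_mulVec_injective {k σ m n : Type*} [Field k] [Fintype m] [Fintype n]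
    (A : Matrix m n (MvPolynomial σ k)) (w₀ : σ → k)
    (h : ∀ v, (A.map (eval w₀)).mulVec v = 0 → v = 0) :
    ∃ P : MvPolynomial σ k, eval w₀ P ≠ 0 ∧
      ∀ w, eval w P ≠ 0 → ∀ v, (A.map (eval w)).mulVec v = 0 → v = 0 := by
  classical
  obtain ⟨g, hg⟩ := LinearMap.exists_leftInverse_of_injective (Matrix.toLin' (A.map (eval w₀)))
    (LinearMap.ker_eq_bot'.2 fun v hv => h v (by rwa [Matrix.toLin'_apply] at hv))
  obtain ⟨B, rfl⟩ := Matrix.toLin'.surjective g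
  rw [← Matrix.toLin'_mul, ← Matrix.toLin'_one] at hg
  have hB := Matrix.toLin'.injective hg
  obtain ⟨B', hB'⟩ : ∃ B' : Matrix n m (MvPolynomial σ k), B' = B.map C := ⟨_, rfl⟩
  have hev : ∀ w, eval w (Matrix.det (B' * A)) = (B * A.map (eval w)).det := by
    intro w
    rw [RingHom.map_det, RingHom.mapMatrix_apply, Matrix.map_mul, hB', Matrix.map_map]
    congr 2
    ext i j
    simp
  refine ⟨Matrix.det (B' * A), by rw [hev, hB, Matrix.det_one]; exact one_ne_zero, ?_⟩
  intro w hw v hv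
  rw [hev] at hw
  refine Matrix.eq_zero_of_mulVec_eq_zero hw ?_
  rw [← Matrix.mulVec_mulVec, hv, Matrix.mulVec_zero]

/-- Surjectivity of a polynomially parametrized matrix is an open condition. -/
lemma exists_eval_ne_zero_of_mulVec_surjective {k σ m n : Type*} [Field k] [Fintype m] [Fintype n]
    (A : Matrix m n (MvPolynomial σ k)) (w₀ : σ → k)
    (h : Function.Surjective (A.map (eval w₀)).mulVec) :
    ∃ P : MvPolynomial σ k, eval w₀ P ≠ 0 ∧
      ∀ w, eval w P ≠ 0 → Function.Surjective (A.map (eval w)).mulVec := by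
  classical
  obtain ⟨B, hB⟩ := Matrix.mulVec_surjective_iff_exists_right_inverse.1 h
  obtain ⟨B', hB'⟩ : ∃ B' : Matrix n m (MvPolynomial σ k), B' = B.map C := ⟨_, rfl⟩
  have hev : ∀ w, eval w (Matrix.det (A * B')) = (A.map (eval w) * B).det := by
    intro w
    rw [RingHom.map_det, RingHom.mapMatrix_apply, Matrix.map_mul, hB', Matrix.map_map]
    congr 2
    ext i j
    simp
  refine ⟨Matrix.det (A * B'), by rw [hev, hB, Matrix.det_one]; exact one_ne_zero, ?_⟩
  intro w hw
  rw [hev] at hw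
  rw [Matrix.mulVec_surjective_iff_exists_right_inverse]
  refine ⟨B * (A.map (eval w) * B)⁻¹, ?_⟩
  rw [← Matrix.mul_assoc, Matrix.mul_nonsing_inv _ (isUnit_iff_ne_zero.2 hw)]

lemma exists_eval_ne_zero_of_formsInjective {k σ : Type*} [Field k] {r d s : ℕ}
    {G : Fin r → MvPolynomial (Fin 2) (MvPolynomial σ k)} (hG : ∀ i, (G i).IsHomogeneous d)
    (w₀ : σ → k) (h : FormsInjective (fun i => map (eval w₀) (G i)) s) :
    ∃ P : MvPolynomial σ k, eval w₀ P ≠ 0 ∧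
      ∀ w, eval w P ≠ 0 → FormsInjective (fun i => map (eval w) (G i)) s := by
  simp_rw [fun w => formsInjective_iff (s := s) (fun i => (hG i).map (eval w)),
    ← mulMatrix_map] at h ⊢
  exact exists_eval_ne_zero_of_mulVec_injective _ w₀ h

lemma exists_eval_ne_zero_of_formsSurjective {k σ : Type*} [Field k] {r d s : ℕ}
    {G : Fin r → MvPolynomial (Fin 2) (MvPolynomial σ k)} (hG : ∀ i, (G i).IsHomogeneous d)
    (w₀ : σ → k) (h : FormsSurjective (fun i => map (eval w₀) (G i)) d s) :
    ∃ P : MvPolynomial σ k, eval w₀ P ≠ 0 ∧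
      ∀ w, eval w P ≠ 0 → FormsSurjective (fun i => map (eval w) (G i)) d s := by
  simp_rw [fun w => formsSurjective_iff (s := s) (fun i => (hG i).map (eval w)),
    ← mulMatrix_map] at h ⊢
  exact exists_eval_ne_zero_of_mulVec_surjective _ w₀ h

lemma formsInjective_monomial {k : Type*} [Field k] {r s : ℕ} {v : Fin r → Fin 2 →₀ ℕ}
    (h : ∀ i j, i ≠ j → ∀ e : Fin 2 →₀ ℕ, e.degree = s → ¬ v j ≤ e + v i) :
    FormsInjective (fun i => (monomial (v i) 1 : MvPolynomial (Fin 2) k)) s := by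
  classical
  intro a ha h0
  funext i
  refine (ha i).ext_coeff (isHomogeneous_zero _ _ _) fun e => ?_
  have h1 := congrArg (coeff (e.1 + v i)) h0
  rw [coeff_sum, Finset.sum_eq_single i] at h1
  · simpa [coeff_mul_monomial] using h1
  · intro j _ hj
    rw [coeff_mul_monomial', if_neg (h i j hj.symm e.1 e.2)]
  · simp

lemma formsSurjective_monomial {k : Type*} [Field k] {r d s : ℕ} {v : Fin r → Fin 2 →₀ ℕ}
    (hv : ∀ i, (v i).degree = d)
    (h : ∀ e : Fin 2 →₀ ℕ, e.degree = d + s → ∃ i, v i ≤ e) :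
    FormsSurjective (fun i => (monomial (v i) 1 : MvPolynomial (Fin 2) k)) d s := by
  classical
  intro p hp
  choose χ hχ using fun e : {e : Fin 2 →₀ ℕ // e.degree = d + s} => h e.1 e.2
  refine ⟨fun i => ∑ e with χ e = i, monomial (e.1 - v i) (coeff e.1 p), fun i => ?_, ?_⟩
  · refine IsHomogeneous.sum _ _ _ fun e he => isHomogeneous_monomial _ ?_
    obtain rfl := (Finset.mem_filter.1 he).2
    have h1 := congrArg Finsupp.degree (tsub_add_cancel_of_le (hχ e))
    rw [map_add, hv, e.2] at h1
    omega
  · conv_rhs => rw [← formOfCoeffs_coeff hp, formOfCoeffs, ← Finset.sum_fiberwise Finset.univ χ]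
    refine Finset.sum_congr rfl fun i _ => ?_
    rw [Finset.sum_mul]
    refine Finset.sum_congr rfl fun e he => ?_
    obtain rfl := (Finset.mem_filter.1 he).2
    rw [monomial_mul, mul_one, tsub_add_cancel_of_le (hχ e)]

lemma formOf_single {k : Type*} [Field k] (d : ℕ) (l : Fin (d + 1)) :
    formOf d (Pi.single l (1 : k)) =
      monomial (Finsupp.single 0 (l : ℕ) + Finsupp.single 1 (d - (l : ℕ))) 1 := by
  classical
  rw [formOf, Finset.sum_eq_single l]
  · rw [Pi.single_eq_same, C_1, one_mul, X_pow_eq_monomial, X_pow_eq_monomial, monomial_mul,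
      one_mul]
  · intro b _ hb
    rw [Pi.single_eq_of_ne hb, C_0, zero_mul, zero_mul]
  · simp

lemma isHomogeneous_sum_C_mul_X_pow {A : Type*} [CommRing A] (d : ℕ) (c : Fin (d + 1) → A) :
    (∑ l : Fin (d + 1), C (c l) * X 0 ^ (l : ℕ) * X 1 ^ (d - (l : ℕ)) :
      MvPolynomial (Fin 2) A).IsHomogeneous d := by
  refine IsHomogeneous.sum _ _ _ fun l _ => ?_
  have h := ((isHomogeneous_C (Fin 2) (c l)).mul (isHomogeneous_X_pow (R := A) (0 : Fin 2) l)).mul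
    (isHomogeneous_X_pow (R := A) (1 : Fin 2) (d - l))
  have e : 0 + (l : ℕ) + (d - (l : ℕ)) = d := by omega
  rwa [e] at h

lemma isHomogeneous_formOf {k : Type*} [Field k] (d : ℕ) (c : Fin (d + 1) → k) :
    (formOf d c).IsHomogeneous d :=
  isHomogeneous_sum_C_mul_X_pow d c

/-- The exponents of `x ^ d`, `y ^ d`, `x ^ (d - m) * y ^ m`. -/
def witnessExponent (d m : ℕ) : Fin 3 → Fin 2 →₀ ℕ :=
  ![Finsupp.single 0 d, Finsupp.single 1 d, Finsupp.single 0 (d - m) + Finsupp.single 1 m]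

lemma finTwo_finsupp_le_iff {e e' : Fin 2 →₀ ℕ} : e ≤ e' ↔ e 0 ≤ e' 0 ∧ e 1 ≤ e' 1 := by
  rw [Finsupp.le_def, Fin.forall_fin_two]

lemma finTwo_finsupp_degree (e : Fin 2 →₀ ℕ) : e.degree = e 0 + e 1 := by
  rw [Finsupp.degree_eq_sum, Fin.sum_univ_two]

lemma degree_witnessExponent {d m : ℕ} (hm : m ≤ d) (i : Fin 3) :
    (witnessExponent d m i).degree = d := by
  rw [finTwo_finsupp_degree]
  fin_cases i <;> simp [witnessExponent]
  omega

lemma formsInjective_witness {k : Type*} [Field k] {d m s : ℕ} (hm : 2 * m ≤ d) (hs : s < m) :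
    FormsInjective (fun i => (monomial (witnessExponent d m i) 1 : MvPolynomial (Fin 2) k)) s := by
  refine formsInjective_monomial fun i j hij e he => ?_
  rw [finTwo_finsupp_degree] at he
  rw [finTwo_finsupp_le_iff]
  fin_cases i <;> fin_cases j <;> simp [witnessExponent] at hij ⊢ <;> omega

lemma formsSurjective_witness {k : Type*} [Field k] {d m : ℕ} (hm : d ≤ 2 * m + 1)
    (hm' : m ≤ d) :
    FormsSurjective (fun i => (monomial (witnessExponent d m i) 1 : MvPolynomial (Fin 2) k))
      d m := by
  refine formsSurjective_monomial (degree_witnessExponent hm') fun e he => ?_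
  rw [finTwo_finsupp_degree] at he
  simp_rw [finTwo_finsupp_le_iff, Fin.exists_fin_succ]
  simp [witnessExponent]
  omega

/-- The exponents of `x ^ d`, `y ^ d`. -/
def witnessExponentPair (d : ℕ) : Fin 2 → Fin 2 →₀ ℕ :=
  ![Finsupp.single 0 d, Finsupp.single 1 d]

lemma formsInjective_witnessPair {k : Type*} [Field k] {d s : ℕ} (hs : s < d) :
    FormsInjective (fun i => (monomial (witnessExponentPair d i) 1 : MvPolynomial (Fin 2) k))
      s := by
  refine formsInjective_monomial fun i j hij e he => ?_
  rw [finTwo_finsupp_degree] at he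
  rw [finTwo_finsupp_le_iff]
  fin_cases i <;> fin_cases j <;> simp [witnessExponentPair] at hij ⊢ <;> omega

lemma formsSurjective_witnessPair {k : Type*} [Field k] {d s : ℕ} (hs : d ≤ s + 1) :
    FormsSurjective (fun i => (monomial (witnessExponentPair d i) 1 : MvPolynomial (Fin 2) k))
      d s := by
  refine formsSurjective_monomial (fun i => ?_) fun e he => ?_
  · fin_cases i <;> simp [witnessExponentPair]
  · rw [finTwo_finsupp_degree] at he
    simp_rw [finTwo_finsupp_le_iff, Fin.exists_fin_succ]
    simp [witnessExponentPair]
    omega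

/-- For general ternary tuples of forms and general pairs of linear combinations, multiplication
by the forms has maximal rank in the degrees which matter, and the pairs are independent. -/
lemma exists_genericity_polynomial (k : Type*) [Field k] {d m : ℕ} (hm₀ : 0 < m)
    (hm : 2 * m ≤ d) (hm' : d ≤ 2 * m + 1) :
    ∃ P : MvPolynomial ((Fin 3 × Fin (d + 1)) ⊕ (Fin 2 × Fin 3)) k, P ≠ 0 ∧
      ∀ (c : Fin 3 → Fin (d + 1) → k) (u : Fin 2 → Fin 3 → k),
        eval (Sum.elim (fun p => c p.1 p.2) (fun p => u p.1 p.2)) P ≠ 0 →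
          FormsInjective (fun j => formOf d (c j)) (m - 1) ∧
          FormsSurjective (fun j => formOf d (c j)) d m ∧
          FormsInjective (fun i => ∑ j : Fin 3, C (u i j) * formOf d (c j)) (d - 2) ∧
          FormsSurjective (fun i => ∑ j : Fin 3, C (u i j) * formOf d (c j)) d (d - 1) ∧
          u 0 0 * u 1 1 - u 0 1 * u 1 0 ≠ 0 := by
  classical
  let σ := (Fin 3 × Fin (d + 1)) ⊕ (Fin 2 × Fin 3)
  let F : Fin 3 → MvPolynomial (Fin 2) (MvPolynomial σ k) := fun j =>
    ∑ l : Fin (d + 1), C (X (Sum.inl (j, l))) * X 0 ^ (l : ℕ) * X 1 ^ (d - (l : ℕ))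
  let H : Fin 2 → MvPolynomial (Fin 2) (MvPolynomial σ k) := fun i =>
    ∑ j : Fin 3, C (X (Sum.inr (i, j))) * F j
  have hF : ∀ j, (F j).IsHomogeneous d := fun j => isHomogeneous_sum_C_mul_X_pow d _
  have hH : ∀ i, (H i).IsHomogeneous d := fun i =>
    IsHomogeneous.sum _ _ _ fun j _ => (hF j).C_mul _
  have mapF : ∀ (c : Fin 3 → Fin (d + 1) → k) (u : Fin 2 → Fin 3 → k),
      (fun j => map (eval (Sum.elim (fun p => c p.1 p.2) (fun p => u p.1 p.2))) (F j)) =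
        fun j => formOf d (c j) := fun c u => by
    funext j
    simp [F, formOf]
  have mapH : ∀ (c : Fin 3 → Fin (d + 1) → k) (u : Fin 2 → Fin 3 → k),
      (fun i => map (eval (Sum.elim (fun p => c p.1 p.2) (fun p => u p.1 p.2))) (H i)) =
        fun i => ∑ j : Fin 3, C (u i j) * formOf d (c j) := fun c u => by
    funext i
    simp [H, F, formOf]
  let c₀ : Fin 3 → Fin (d + 1) → k :=
    ![Pi.single (Fin.last d) 1, Pi.single 0 1, Pi.single ⟨d - m, by omega⟩ 1]
  let u₀ : Fin 2 → Fin 3 → k := ![Pi.single 0 1, Pi.single 1 1]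
  have hF₀ : (fun j => formOf d (c₀ j)) = fun j => monomial (witnessExponent d m j) 1 := by
    have e : d - (d - m) = m := by omega
    funext j
    fin_cases j <;> simp [c₀, formOf_single, witnessExponent, e]
  have hH₀ : (fun i => ∑ j : Fin 3, C (u₀ i j) * formOf d (c₀ j)) =
      fun i => monomial (witnessExponentPair d i) 1 := by
    funext i
    fin_cases i <;>
      simp [u₀, c₀, Fin.sum_univ_three, formOf_single, witnessExponentPair]
  obtain ⟨P₁, hP₁, H₁⟩ := exists_eval_ne_zero_of_formsInjective (s := m - 1) hF _
    (by rw [mapF c₀ u₀, hF₀]; exact formsInjective_witness hm (by omega))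
  obtain ⟨P₂, hP₂, H₂⟩ := exists_eval_ne_zero_of_formsSurjective (s := m) hF _
    (by rw [mapF c₀ u₀, hF₀]; exact formsSurjective_witness hm' (by omega))
  obtain ⟨P₃, hP₃, H₃⟩ := exists_eval_ne_zero_of_formsInjective (s := d - 2) hH _
    (by rw [mapH c₀ u₀, hH₀]; exact formsInjective_witnessPair (by omega))
  obtain ⟨P₄, hP₄, H₄⟩ := exists_eval_ne_zero_of_formsSurjective (s := d - 1) hH _
    (by rw [mapH c₀ u₀, hH₀]; exact formsSurjective_witnessPair (by omega))
  let P₅ : MvPolynomial σ k := X (Sum.inr (0, 0)) * X (Sum.inr (1, 1)) -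
    X (Sum.inr (0, 1)) * X (Sum.inr (1, 0))
  have hP₅ : eval (Sum.elim (fun p => c₀ p.1 p.2) (fun p => u₀ p.1 p.2)) P₅ ≠ 0 := by
    simp [P₅, u₀]
  refine ⟨P₁ * P₂ * P₃ * P₄ * P₅, fun h0 => ?_, fun c u h => ?_⟩
  · have := congrArg (eval (Sum.elim (fun p => c₀ p.1 p.2) (fun p => u₀ p.1 p.2))) h0
    simp only [map_mul, map_zero, mul_eq_zero] at this
    tauto
  · simp only [map_mul, ne_eq, mul_eq_zero, not_or] at h
    obtain ⟨⟨⟨⟨h₁, h₂⟩, h₃⟩, h₄⟩, h₅⟩ := h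
    refine ⟨mapF c u ▸ H₁ _ h₁, mapF c u ▸ H₂ _ h₂, mapH c u ▸ H₃ _ h₃, mapH c u ▸ H₄ _ h₄, ?_⟩
    simpa [P₅] using h₅

/-- If two linear combinations have a nonvanishing minor, they generate the span of three elements
together with the third one. -/
lemma span_triple_eq_sup {k : Type*} [Field k] (f : Fin 3 → MvPolynomial (Fin 2) k)
    (u : Fin 2 → Fin 3 → k) (hu : u 0 0 * u 1 1 - u 0 1 * u 1 0 ≠ 0) :
    Ideal.span {f 0, f 1, f 2} =
      Ideal.span {∑ j : Fin 3, C (u 0 j) * f j, ∑ j : Fin 3, C (u 1 j) * f j} ⊔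
        Ideal.span {f 2} := by
  set D := u 0 0 * u 1 1 - u 0 1 * u 1 0 with hD
  have hC : (C D⁻¹ : MvPolynomial (Fin 2) k) * C D = 1 := by
    rw [← C_mul, inv_mul_cancel₀ hu, C_1]
  have hCD : (C D : MvPolynomial (Fin 2) k) = C (u 0 0) * C (u 1 1) - C (u 0 1) * C (u 1 0) := by
    simp [hD]
  refine le_antisymm ?_ (sup_le ?_ ?_)
  · set J := Ideal.span {∑ j : Fin 3, C (u 0 j) * f j, ∑ j : Fin 3, C (u 1 j) * f j} with hJ
    have hg₀ : ∑ j : Fin 3, C (u 0 j) * f j ∈ J ⊔ Ideal.span {f 2} :=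
      Ideal.mem_sup_left (Ideal.subset_span (by simp))
    have hg₁ : ∑ j : Fin 3, C (u 1 j) * f j ∈ J ⊔ Ideal.span {f 2} :=
      Ideal.mem_sup_left (Ideal.subset_span (by simp))
    have hf₂ : f 2 ∈ J ⊔ Ideal.span {f 2} :=
      Ideal.mem_sup_right (Ideal.mem_span_singleton_self _)
    rw [Ideal.span_le]
    rintro _ (rfl | rfl | rfl)
    · have := Ideal.mul_mem_left _ (C D⁻¹) (sub_mem (sub_mem (Ideal.mul_mem_left _ (C (u 1 1)) hg₀)
        (Ideal.mul_mem_left _ (C (u 0 1)) hg₁))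
        (Ideal.mul_mem_left _ (C (u 1 1) * C (u 0 2) - C (u 0 1) * C (u 1 2)) hf₂))
      rw [SetLike.mem_coe]
      convert this using 1
      rw [Fin.sum_univ_three, Fin.sum_univ_three]
      linear_combination (-f 0) * hC + C D⁻¹ * f 0 * hCD
    · have := Ideal.mul_mem_left _ (C D⁻¹) (sub_mem (sub_mem (Ideal.mul_mem_left _ (C (u 0 0)) hg₁)
        (Ideal.mul_mem_left _ (C (u 1 0)) hg₀))
        (Ideal.mul_mem_left _ (C (u 0 0) * C (u 1 2) - C (u 1 0) * C (u 0 2)) hf₂))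
      rw [SetLike.mem_coe]
      convert this using 1
      rw [Fin.sum_univ_three, Fin.sum_univ_three]
      linear_combination (-f 1) * hC + C D⁻¹ * f 1 * hCD
    · exact hf₂
  · have hmem : ∀ j, f j ∈ Ideal.span {f 0, f 1, f 2} := fun j =>
      Ideal.subset_span (by fin_cases j <;> simp)
    rw [Ideal.span_le]
    rintro _ (rfl | rfl) <;>
    exact Ideal.sum_mem _ fun j _ => Ideal.mul_mem_left _ _ (hmem j)
  · exact Ideal.span_mono (by simp)

lemma range_finThree {α : Type*} (f : Fin 3 → α) : Set.range f = {f 0, f 1, f 2} := by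
  ext a
  simp [Fin.exists_fin_succ, eq_comm]

lemma range_finTwo {α : Type*} (f : Fin 2 → α) : Set.range f = {f 0, f 1} := by
  ext a
  simp [Fin.exists_fin_succ, eq_comm]

lemma length_arith {d m a b : ℕ} (hm₀ : 0 < m) (hmd : m = d / 2) (hd : 2 ≤ d)
    (ha : a + 3 * ((m - 1 + 1) * (m - 1 + 2) / 2) = (d + (m - 1) + 1) * (d + (m - 1) + 2) / 2)
    (hb : b + 2 * ((d - 2 + 1) * (d - 2 + 2) / 2) = (d + (d - 2) + 1) * (d + (d - 2) + 2) / 2) :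
    b = (if Even d then d ^ 2 / 4 else (d ^ 2 - 1) / 4) + a := by
  have tri : ∀ n t : ℕ, (n + 1) * (n + 2) / 2 = t → 2 * t = (n + 1) * (n + 2) := by
    rintro n t rfl
    have : 2 ∣ (n + 1) * (n + 2) := (Nat.even_mul_succ_self (n + 1)).two_dvd
    omega
  obtain ⟨s, rfl⟩ : ∃ s, m = s + 1 := ⟨m - 1, by omega⟩
  obtain ⟨t, rfl⟩ : ∃ t, d = t + 2 := ⟨d - 2, by omega⟩
  simp only [Nat.add_sub_cancel] at ha hb
  generalize h1 : (s + 1) * (s + 2) / 2 = t1 at ha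
  generalize h2 : (t + 2 + s + 1) * (t + 2 + s + 2) / 2 = t2 at ha
  generalize h3 : (t + 1) * (t + 2) / 2 = t3 at hb
  generalize h4 : (t + 2 + t + 1) * (t + 2 + t + 2) / 2 = t4 at hb
  replace h1 := tri _ _ h1
  replace h2 := tri _ _ h2
  replace h3 := tri _ _ h3
  replace h4 := tri _ _ h4
  rcases Nat.even_or_odd (t + 2) with he | ho
  · rw [if_pos he]
    obtain ⟨r, hr⟩ := he
    obtain rfl : t = 2 * s := by omega
    have : (2 * s + 2) ^ 2 / 4 = (s + 1) ^ 2 := by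
      rw [show (2 * s + 2) ^ 2 = 4 * (s + 1) ^ 2 by ring]
      omega
    rw [this]
    nlinarith
  · rw [if_neg (Nat.not_even_iff_odd.2 ho)]
    obtain ⟨r, hr⟩ := ho
    obtain rfl : t = 2 * s + 1 := by omega
    have : ((2 * s + 1 + 2) ^ 2 - 1) / 4 = (s + 1) ^ 2 + (s + 1) := by
      rw [show (2 * s + 1 + 2) ^ 2 = 4 * ((s + 1) ^ 2 + (s + 1)) + 1 by ring]
      omega
    rw [this]
    nlinarith

/-- For an infinite field `k` and `d ≥ 5`, for general forms `f₁, f₂, f₃` of degree `d`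
in `R = k[x,y]` together with two general `k`-linear combinations `g₁, g₂` of them
(genericity encoded as the nonvanishing locus of a nonzero polynomial), with
`I = (f₁,f₂,f₃)`, the ideal `J = (g₁,g₂)` is a minimal reduction of `I` and
`λ(I/J) = d²/4` if `d` is even, `λ(I/J) = (d²−1)/4` if `d` is odd. -/
theorem length_I_mod_J_general_binary_forms (k : Type*) [Field k] [Infinite k]
    (d : ℕ) (hd : 5 ≤ d) :
    ∃ P : MvPolynomial ((Fin 3 × Fin (d + 1)) ⊕ (Fin 2 × Fin 3)) k, P ≠ 0 ∧
      ∀ (c : Fin 3 → Fin (d + 1) → k) (u : Fin 2 → Fin 3 → k),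
        eval (Sum.elim (fun p => c p.1 p.2) (fun p => u p.1 p.2)) P ≠ 0 →
          IsMinimalReduction
            (Ideal.span {formOf d (c 0), formOf d (c 1), formOf d (c 2)})
            (Ideal.span {∑ j : Fin 3, C (u 0 j) * formOf d (c j),
                          ∑ j : Fin 3, C (u 1 j) * formOf d (c j)}) ∧
          moduleLength (MvPolynomial (Fin 2) k)
            (↥(Ideal.span {formOf d (c 0), formOf d (c 1), formOf d (c 2)}) ⧸
              Submodule.comap
                (Ideal.span {formOf d (c 0), formOf d (c 1), formOf d (c 2)}).subtype
                (Ideal.span {∑ j : Fin 3, C (u 0 j) * formOf d (c j),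
                              ∑ j : Fin 3, C (u 1 j) * formOf d (c j)})) =
            (if Even d then d ^ 2 / 4 else (d ^ 2 - 1) / 4 : ℕ) := by
  obtain ⟨m, hmd⟩ : ∃ m, m = d / 2 := ⟨_, rfl⟩
  obtain ⟨P, hP, H⟩ := exists_genericity_polynomial k (d := d) (m := m) (by omega) (by omega)
    (by omega)
  refine ⟨P, hP, fun c u hcu => ?_⟩
  obtain ⟨hfi, hfs, hgi, hgs, hu⟩ := H c u hcu
  have hf : ∀ j, (formOf d (c j)).IsHomogeneous d := fun j => isHomogeneous_formOf d _
  have hg : ∀ i, (∑ j : Fin 3, C (u i j) * formOf d (c j)).IsHomogeneous d := fun i =>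
    IsHomogeneous.sum _ _ _ fun j _ => (hf j).C_mul _
  have hIJ := span_triple_eq_sup (fun j => formOf d (c j)) u hu
  have hfin_I := finrank_quotient_span_forms hf hfi
    (by rwa [show m - 1 + 1 = m by omega])
  have hfin_J := finrank_quotient_span_forms hg hgi
    (by rwa [show d - 2 + 1 = d - 1 by omega])
  have hN_I := hfs.pow_le.trans Ideal.mul_le_left
  have hpow := hgs.pow_le
  rw [range_finThree] at hfin_I hN_I
  rw [range_finTwo] at hfin_J hpow
  have hN_J := hpow.trans Ideal.mul_le_left
  set I := Ideal.span {formOf d (c 0), formOf d (c 1), formOf d (c 2)} with hI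
  set J := Ideal.span {∑ j : Fin 3, C (u 0 j) * formOf d (c j),
    ∑ j : Fin 3, C (u 1 j) * formOf d (c j)} with hJ
  have hJI : J ≤ I := hIJ ▸ le_sup_left
  refine ⟨⟨?_, fun J' hr hJ' => ?_⟩, ?_⟩
  · rw [hIJ]
    refine isReduction_sup_span_singleton (K := idealOfVars (Fin 2) k ^ (d - 1))
      (IsNoetherian.noetherian _) ?_ fun a ha => ?_
    · refine (Submodule.ne_bot_iff _).2
        ⟨X 0 ^ (d - 1), Ideal.pow_mem_pow (Ideal.subset_span (Set.mem_range_self 0)) _,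
          pow_ne_zero _ (X_ne_zero _)⟩
    · refine hpow ?_
      rw [pow_add]
      exact Ideal.mul_mem_mul (hf 2).mem_pow_idealOfVars ha
  · refine eq_span_pair_of_isReduction (by omega) (hg 0) (hg 1) hJI ?_ hN_J hr hJ'
    rw [hI, Ideal.span_le]
    rintro _ (rfl | rfl | rfl) <;> exact (hf _).mem_pow_idealOfVars
  · obtain ⟨_, hI'⟩ := hfin_I
    obtain ⟨_, hJ'⟩ := hfin_J
    have hlen := length_quotient_eq_add hJI
    rw [length_quotient_eq_finrank hN_I, length_quotient_eq_finrank hN_J,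
      length_arith (by omega) hmd (by omega) hI' hJ', Nat.cast_add] at hlen
    rw [moduleLength, ← Module.length_eq_height]
    exact ((ENat.add_left_injective_of_ne_top (ENat.natCast_ne_top _)) hlen).symm
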